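/- (Compactness for unbounded potential energy, Theorem 4.2.) Assume b − a ≤ √(c₁/(4c₂)). If (π^{(N)})_{N∈ℕ} is a sequence in 𝒫(C([a,b];ℝⁿ)) such that there is one compact set K ⊆ ℝⁿ with (pr_a#π^{(N)})(K) = 1 for all N, and sup_N 𝔸(π^{(N)}) < ∞, then (π^{(N)}) is relatively compact with respect to weak convergence: every subsequence admits a further subsequence converging weakly to some element of 𝒫(C([a,b];ℝⁿ)). -/

import Mathlib

open MeasureTheory Filter Topology
open scoped ENNReal NNReal

noncomputable section

/-- Euclidean space `ℝⁿ`. -/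
abbrev Eu (n : ℕ) := EuclideanSpace ℝ (Fin n)

/-- The space `C([a,b];ℝⁿ)` of continuous curves with the supremum metric. -/
abbrev CPath (a b : ℝ) (n : ℕ) := C(Set.Icc a b, Eu n)

/-- We endow the path space with its Borel σ-algebra. -/
noncomputable instance pathMeasurableSpace (a b : ℝ) (n : ℕ) :
    MeasurableSpace (CPath a b n) := borel _

instance pathBorelSpace (a b : ℝ) (n : ℕ) : BorelSpace (CPath a b n) :=
  ⟨rfl⟩

/-- Evaluation of a curve at time `t ∈ [a,b]` (junk value `0` outside `[a,b]`). -/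
def pev {a b : ℝ} {n : ℕ} (γ : CPath a b n) (t : ℝ) : Eu n :=
  if ht : t ∈ Set.Icc a b then γ ⟨t, ht⟩ else 0

/-- A curve is absolutely continuous if it has a Bochner-integrable derivative `g` with
`γ t = γ s + ∫_s^t g`. -/
def IsACC {a b : ℝ} {n : ℕ} (γ : CPath a b n) : Prop :=
  ∃ g : ℝ → Eu n, IntegrableOn g (Set.Icc a b) ∧
    ∀ s t : Set.Icc a b, γ t = γ s + ∫ u in (s : ℝ)..(t : ℝ), g u

open Classical in
/-- The action `𝒜(γ) = ∫_a^b L(γ(t), γ̇(t)) dt ∈ (−∞,+∞]`, equal to `+∞` on curves that are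
not absolutely continuous (and, by the convention that the integral is `+∞` when the
integrand fails to be integrable -- its negative part being automatically integrable --
also on absolutely continuous curves with non-integrable Lagrangian). -/
def action {n : ℕ} (L : Eu n → Eu n → ℝ) (a b : ℝ) (γ : CPath a b n) : EReal :=
  if h : IsACC γ then
    (if IntegrableOn (fun t => L (pev γ t) (h.choose t)) (Set.Icc a b) then
      (((∫ t in Set.Icc a b, L (pev γ t) (h.choose t)) : ℝ) : EReal)
    else ⊤)
  else ⊤

/-- Positive part of an extended real, as `ℝ≥0∞`. -/
def epos (x : EReal) : ℝ≥0∞ := if x = ⊤ then ⊤ else ENNReal.ofReal x.toReal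

/-- The integral `∫ F dπ ∈ [−∞,+∞]` of an extended-real-valued function, defined as the
difference of the lower integrals of the positive and negative parts. -/
def mint {X : Type*} [MeasurableSpace X] (F : X → EReal) (π : Measure X) : EReal :=
  ((∫⁻ γ, epos (F γ) ∂π : ℝ≥0∞) : EReal) - ((∫⁻ γ, epos (-(F γ)) ∂π : ℝ≥0∞) : EReal)

open Classical in
/-- The constrained functional `𝔸_{μa,μb}(π) = ∫ 𝒜 dπ` if `pr_a#π = μa` and `pr_b#π = μb`,
and `+∞` otherwise, for a given (extended-real-valued) action functional `F`. -/
def aFun {a b : ℝ} {n : ℕ} (F : CPath a b n → EReal) (μa μb : Measure (Eu n))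
    (π : Measure (CPath a b n)) : EReal :=
  if Measure.map (fun γ => pev γ a) π = μa ∧ Measure.map (fun γ => pev γ b) π = μb then
    mint F π
  else ⊤

/-- Weak convergence of a sequence of measures: convergence of the integrals of all bounded
continuous functions. -/
def WeakLim {X : Type*} [TopologicalSpace X] [MeasurableSpace X]
    (πs : ℕ → Measure X) (π : Measure X) : Prop :=
  ∀ φ : BoundedContinuousFunction X ℝ,
    Tendsto (fun N => ∫ x, φ x ∂(πs N)) atTop (𝓝 (∫ x, φ x ∂π))

/-- The empirical measure `(1/N) ∑_{i=1}^N δ_{x i}`. -/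
def emp {X : Type*} [MeasurableSpace X] (N : ℕ) (x : Fin N → X) : Measure X :=
  (N : ℝ≥0∞)⁻¹ • ∑ i : Fin N, Measure.dirac (x i)

/-- The topological support of a measure. -/
def msupp {α : Type*} [TopologicalSpace α] [MeasurableSpace α] (μ : Measure α) : Set α :=
  {x | ∀ U : Set α, IsOpen U → x ∈ U → 0 < μ U}

/-- The set `Γ^min_{K₁,K₂}` of minimizing extremals starting in `K₁` and ending in `K₂`. -/
def GammaMin {n : ℕ} (L : Eu n → Eu n → ℝ) (a b : ℝ) (K₁ K₂ : Set (Eu n)) :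
    Set (CPath a b n) :=
  {γ | IsACC γ ∧ pev γ a ∈ K₁ ∧ pev γ b ∈ K₂ ∧
    ∀ γ' : CPath a b n, IsACC γ' → pev γ' a = pev γ a → pev γ' b = pev γ b →
      action L a b γ ≤ action L a b γ'}

/-- The Lagrangian cost `c(x,y)`: the minimal action among absolutely continuous curves
from `x` to `y`. -/
def cost {n : ℕ} (L : Eu n → Eu n → ℝ) (a b : ℝ) (x y : Eu n) : EReal :=
  ⨅ γ ∈ {γ : CPath a b n | IsACC γ ∧ pev γ a = x ∧ pev γ b = y}, action L a b γ

/-- The restriction of a continuous curve `ℝ → ℝⁿ` to `[a,b]` as an element of the path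
space. -/
def toPath {n : ℕ} (a b : ℝ) (f : ℝ → Eu n) (hf : Continuous f) : CPath a b n :=
  (ContinuousMap.mk f hf).restrict (Set.Icc a b)

/-- `Φ : ℝⁿ × ℝⁿ → C([a,b];ℝⁿ)` is the Euler–Lagrange (Newton) flow map for the Lagrangian
`L(x,v) = (m/2)|v|² − V(x)`: it is continuous and `Φ(x,v)` is a `C²` solution of
`m γ'' = −∇V(γ)` with initial position `x` and initial velocity `v`. -/
def IsNewtonFlow {n : ℕ} (m : ℝ) (V : Eu n → ℝ) (a b : ℝ)
    (Φ : Eu n × Eu n → CPath a b n) : Prop :=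
  Continuous Φ ∧ ∀ x v : Eu n, ∃ f : ℝ → Eu n, ContDiff ℝ 2 f ∧
    (∀ t : Set.Icc a b, Φ (x, v) t = f t) ∧ f a = x ∧ deriv f a = v ∧
    ∀ t ∈ Set.Icc a b, m • deriv (deriv f) t = -gradient V (f t)

/-- The set of `C²` solutions of `m γ'' = −∇V(γ)` starting in `Ka` and ending in `Kb`,
viewed as a subset of the path space. -/
def NewtonSet {n : ℕ} (m : ℝ) (V : Eu n → ℝ) (a b : ℝ) (Ka Kb : Set (Eu n)) :
    Set (CPath a b n) :=
  {γ | ∃ f : ℝ → Eu n, ContDiff ℝ 2 f ∧ (∀ t : Set.Icc a b, γ t = f t) ∧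
    (∀ t ∈ Set.Icc a b, m • deriv (deriv f) t = -gradient V (f t)) ∧
    f a ∈ Ka ∧ f b ∈ Kb}

/-- `γ` is piecewise affine subordinate to the partition `a = τ₀ < … < τ_l = b`. -/
def PiecewiseAffine {n : ℕ} (a b : ℝ) (τ : ℕ → ℝ) (l : ℕ) (γ : CPath a b n) : Prop :=
  ∀ j < l, ∀ t : Set.Icc a b, (t : ℝ) ∈ Set.Icc (τ j) (τ (j + 1)) →
    γ t = pev γ (τ j) + (((t : ℝ) - τ j) / (τ (j + 1) - τ j)) •
      (pev γ (τ (j + 1)) - pev γ (τ j))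

/-- `IsPartition a b τ l h`: `a = τ₀ < τ₁ < … < τ_l = b` is a partition of `[a,b]` of mesh
at most `h`. -/
def IsPartition (a b : ℝ) (τ : ℕ → ℝ) (l : ℕ) (h : ℝ) : Prop :=
  1 ≤ l ∧ τ 0 = a ∧ τ l = b ∧ (∀ j < l, τ j < τ (j + 1)) ∧
    ∀ j < l, τ (j + 1) - τ j ≤ h

/-- The midpoint-rule discrete action, as a (real-valued) sum over the first `l` intervals
of the partition. -/
def dActionSum {n : ℕ} (m : ℝ) (V : Eu n → ℝ) {a b : ℝ} (τ : ℕ → ℝ) (l : ℕ)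
    (γ : CPath a b n) : ℝ :=
  ∑ j ∈ Finset.range l,
    (m / 2 * ‖pev γ (τ (j + 1)) - pev γ (τ j)‖ ^ 2 / (τ (j + 1) - τ j) -
      V ((2 : ℝ)⁻¹ • (pev γ (τ (j + 1)) + pev γ (τ j))) * (τ (j + 1) - τ j))

open Classical in
/-- The discrete action `𝒜^{[h]}`: the midpoint-rule discrete action for piecewise affine
curves subordinate to the partition, `+∞` otherwise. -/
def dAction {n : ℕ} (m : ℝ) (V : Eu n → ℝ) (a b : ℝ) (τ : ℕ → ℝ) (l : ℕ)
    (γ : CPath a b n) : EReal :=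
  if PiecewiseAffine a b τ l γ then ((dActionSum m V τ l γ : ℝ) : EReal) else ⊤

/-- The discrete Euler–Lagrange equations for a piecewise affine curve subordinate to the
partition `a = τ₀ < … < τ_l = b`. -/
def DiscreteEL {n : ℕ} (m : ℝ) (V : Eu n → ℝ) {a b : ℝ} (τ : ℕ → ℝ) (l : ℕ)
    (γ : CPath a b n) : Prop :=
  ∀ j, 1 ≤ j → j < l →
    m • ((τ j - τ (j - 1))⁻¹ • (pev γ (τ j) - pev γ (τ (j - 1)))) -
      m • ((τ (j + 1) - τ j)⁻¹ • (pev γ (τ (j + 1)) - pev γ (τ j))) =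
    ((τ j - τ (j - 1)) / 2) • gradient V ((2 : ℝ)⁻¹ • (pev γ (τ (j - 1)) + pev γ (τ j))) +
      ((τ (j + 1) - τ j) / 2) • gradient V ((2 : ℝ)⁻¹ • (pev γ (τ j) + pev γ (τ (j + 1))))

end

/-- **Arzelà–Ascoli** for curves with a common modulus of continuity `ω` whose value at a base
point `x₀` lies in a common compact set. -/
lemma isCompact_setOf_modulus {X α : Type*} [PseudoMetricSpace X] [CompactSpace X]
    [MetricSpace α] [ProperSpace α] (x₀ : X) {K : Set α} (hK : IsCompact K) {ω : ℝ → ℝ}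
    (hω : Tendsto ω (𝓝 0) (𝓝 0)) :
    IsCompact {γ : C(X, α) | γ x₀ ∈ K ∧ ∀ s t, dist (γ s) (γ t) ≤ ω (dist s t)} := by
  refine ArzelaAscoli.isCompact_of_equicontinuous _ ?_ ?_
  · have himage : ContinuousMap.toFun ''
        {γ : C(X, α) | γ x₀ ∈ K ∧ ∀ s t, dist (γ s) (γ t) ≤ ω (dist s t)} =
        {f : X → α | f x₀ ∈ K ∧ ∀ s t, dist (f s) (f t) ≤ ω (dist s t)} := by
      ext f
      constructor
      · rintro ⟨γ, hγ, rfl⟩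
        exact hγ
      · rintro ⟨hf₀, hf⟩
        have hcont : Continuous f := by
          refine Metric.continuous_iff'.2 fun x ε hε => ?_
          have hdist : Tendsto (fun y => dist y x) (𝓝 x) (𝓝 0) := by
            simpa using (continuous_id.dist (continuous_const (y := x))).tendsto x
          filter_upwards [(hω.comp hdist).eventually_lt_const hε] with y hy
          exact (hf y x).trans_lt hy
        exact ⟨⟨f, hcont⟩, ⟨hf₀, hf⟩, rfl⟩
    rw [himage]
    refine (isCompact_univ_pi fun x => hK.cthickening (r := ω (dist x x₀))).of_isClosed_subset
      ?_ ?_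
    · refine IsClosed.inter (hK.isClosed.preimage (continuous_apply x₀)) ?_
      have hset : {f : X → α | ∀ s t, dist (f s) (f t) ≤ ω (dist s t)} =
          ⋂ s, ⋂ t, {f : X → α | dist (f s) (f t) ≤ ω (dist s t)} := by
        ext f
        simp
      change IsClosed {f : X → α | ∀ s t, dist (f s) (f t) ≤ ω (dist s t)}
      rw [hset]
      exact isClosed_iInter fun s => isClosed_iInter fun t =>
        isClosed_le ((continuous_apply s).dist (continuous_apply t)) continuous_const
    · rintro f ⟨hf₀, hf⟩ x -
      exact Metric.mem_cthickening_of_dist_le _ _ _ _ hf₀ (hf x x₀)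
  · exact Metric.equicontinuous_of_continuity_modulus ω hω _ fun x y γ => γ.2.2 x y

/-- The Cauchy–Schwarz inequality against the constant function `1`. -/
lemma sq_integral_le_measureReal_mul_integral_sq {Ω : Type*} [MeasurableSpace Ω]
    {μ : Measure Ω} [IsFiniteMeasure μ] {f : Ω → ℝ} (hf : Integrable f μ)
    (hf2 : Integrable (fun x => f x ^ 2) μ) :
    (∫ x, f x ∂μ) ^ 2 ≤ μ.real Set.univ * ∫ x, f x ^ 2 ∂μ := by
  have hquad : ∀ c : ℝ, 0 ≤ μ.real Set.univ * (c * c) + (-2 * ∫ x, f x ∂μ) * c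
      + ∫ x, f x ^ 2 ∂μ := by
    intro c
    have hnonneg : 0 ≤ ∫ x, (f x ^ 2 + (-2 * c) * f x + c * c) ∂μ :=
      integral_nonneg fun x => by
        change 0 ≤ f x ^ 2 + (-2 * c) * f x + c * c
        nlinarith [sq_nonneg (f x - c)]
    rw [integral_add (by exact hf2.add (hf.const_mul _)) (integrable_const _),
      integral_add hf2 (hf.const_mul _), integral_const_mul, integral_const, smul_eq_mul]
      at hnonneg
    linarith
  have hdiscrim := discrim_le_zero hquad
  rw [discrim] at hdiscrim
  linarith

section Coercivity

variable {a b : ℝ} {n : ℕ} {γ : CPath a b n} {g : ℝ → Eu n}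

/-- A curve whose derivative is square integrable is `1/2`-Hölder continuous. -/
lemma dist_le_sqrt_of_integrableOn_sq (hg : IntegrableOn g (Set.Icc a b))
    (hγ : ∀ s t : Set.Icc a b, γ t = γ s + ∫ u in (s : ℝ)..(t : ℝ), g u)
    (hg2 : IntegrableOn (fun u => ‖g u‖ ^ 2) (Set.Icc a b)) (s t : Set.Icc a b) :
    dist (γ s) (γ t) ≤ √((∫ u in Set.Icc a b, ‖g u‖ ^ 2) * dist s t) := by
  wlog hst : s ≤ t generalizing s t
  · rw [dist_comm (γ s), dist_comm s]
    exact this t s (le_of_not_ge hst)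
  have hsub : Set.Ioc (s : ℝ) t ⊆ Set.Icc a b := fun u hu =>
    ⟨s.2.1.trans hu.1.le, hu.2.trans t.2.2⟩
  have hst' : (s : ℝ) ≤ t := hst
  refine Real.le_sqrt_of_sq_le ?_
  calc dist (γ s) (γ t) ^ 2
      = ‖∫ u in Set.Ioc (s : ℝ) t, g u‖ ^ 2 := by
        rw [dist_comm, dist_eq_norm, hγ s t, add_sub_cancel_left,
          intervalIntegral.integral_of_le hst']
    _ ≤ (∫ u in Set.Ioc (s : ℝ) t, ‖g u‖) ^ 2 := by
        gcongr
        exact norm_integral_le_integral_norm _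
    _ ≤ (volume.restrict (Set.Ioc (s : ℝ) t)).real Set.univ *
          ∫ u in Set.Ioc (s : ℝ) t, ‖g u‖ ^ 2 :=
        sq_integral_le_measureReal_mul_integral_sq (hg.mono_set hsub).norm (hg2.mono_set hsub)
    _ = (∫ u in Set.Ioc (s : ℝ) t, ‖g u‖ ^ 2) * dist s t := by
        rw [measureReal_restrict_apply_univ, Real.volume_real_Ioc_of_le hst', mul_comm,
          dist_comm s, Subtype.dist_eq, Real.dist_eq, abs_of_nonneg (sub_nonneg.2 hst')]
    _ ≤ (∫ u in Set.Icc a b, ‖g u‖ ^ 2) * dist s t := by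
        gcongr
        · exact ae_of_all _ fun u => by positivity

/-- The curve `t ↦ pev γ t` is continuous on `[a,b]`. -/
lemma continuousOn_pev (γ : CPath a b n) : ContinuousOn (pev γ) (Set.Icc a b) := by
  rw [continuousOn_iff_continuous_domRestrict]
  convert γ.continuous using 1
  ext1 t
  simp [pev]

variable {L : Eu n → Eu n → ℝ} {c₁ c₂ r : ℝ} {x₀ : Eu n}

/-- A curve with integrable Lagrangian has square integrable derivative. -/
lemma integrableOn_sq_of_integrableOn_lagrangian (hc₁ : 0 < c₁)
    (hL : ∀ x v : Eu n, c₁ * ‖v‖ ^ 2 - c₂ * (1 + ‖x - x₀‖ ^ 2) ≤ L x v)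
    (hg : IntegrableOn g (Set.Icc a b))
    (hLγ : IntegrableOn (fun t => L (pev γ t) (g t)) (Set.Icc a b)) :
    IntegrableOn (fun u => ‖g u‖ ^ 2) (Set.Icc a b) := by
  have hV : IntegrableOn (fun t => c₂ * (1 + ‖pev γ t - x₀‖ ^ 2)) (Set.Icc a b) :=
    ContinuousOn.integrableOn_Icc <| continuousOn_const.mul <| continuousOn_const.add <|
      (((continuousOn_pev γ).sub continuousOn_const).norm).pow 2
  refine ((hLγ.add hV).const_mul c₁⁻¹).mono' (hg.aestronglyMeasurable.norm.pow 2) ?_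
  refine ae_of_all _ fun t => ?_
  rw [Real.norm_of_nonneg (by positivity), inv_mul_eq_div, le_div_iff₀ hc₁]
  change _ ≤ L (pev γ t) (g t) + c₂ * (1 + ‖pev γ t - x₀‖ ^ 2)
  linarith [hL (pev γ t) (g t)]

/-- For short times, the action controls the kinetic energy. -/
lemma half_mul_integral_sq_sub_le_integral_lagrangian (hab : a ≤ b) (hc₁ : 0 < c₁)
    (hc₂ : 0 < c₂)
    (hL : ∀ x v : Eu n, c₁ * ‖v‖ ^ 2 - c₂ * (1 + ‖x - x₀‖ ^ 2) ≤ L x v)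
    (htime : b - a ≤ √(c₁ / (4 * c₂)))
    (hg : IntegrableOn g (Set.Icc a b))
    (hγ : ∀ s t : Set.Icc a b, γ t = γ s + ∫ u in (s : ℝ)..(t : ℝ), g u)
    (hr : ‖pev γ a - x₀‖ ≤ r)
    (hLγ : IntegrableOn (fun t => L (pev γ t) (g t)) (Set.Icc a b)) :
    c₁ / 2 * (∫ u in Set.Icc a b, ‖g u‖ ^ 2) - c₂ * (b - a) * (1 + 2 * r ^ 2) ≤
      ∫ t in Set.Icc a b, L (pev γ t) (g t) := by
  have hg2 := integrableOn_sq_of_integrableOn_lagrangian hc₁ hL hg hLγ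
  set G := ∫ u in Set.Icc a b, ‖g u‖ ^ 2 with hG
  have hG0 : 0 ≤ G := integral_nonneg fun u => by positivity
  have hT : 0 ≤ b - a := sub_nonneg.2 hab
  have hpos : ∀ t ∈ Set.Icc a b, ‖pev γ t - x₀‖ ^ 2 ≤ 2 * r ^ 2 + 2 * (b - a) * G := by
    intro t ht
    have ha : a ∈ Set.Icc a b := ⟨le_rfl, hab⟩
    have hdist := dist_le_sqrt_of_integrableOn_sq hg hγ hg2 ⟨t, ht⟩ ⟨a, ha⟩
    have hta : dist (⟨t, ht⟩ : Set.Icc a b) ⟨a, ha⟩ ≤ b - a := by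
      rw [Subtype.dist_eq, Real.dist_eq, abs_of_nonneg (sub_nonneg.2 ht.1)]
      linarith [ht.2]
    have hnorm : ‖pev γ t - pev γ a‖ ^ 2 ≤ (b - a) * G := by
      have hsq : ‖pev γ t - pev γ a‖ ≤ √((b - a) * G) := by
        rw [← dist_eq_norm]
        simp only [pev, ht, ha, dif_pos]
        refine hdist.trans (Real.sqrt_le_sqrt ?_)
        rw [mul_comm]
        gcongr
      calc ‖pev γ t - pev γ a‖ ^ 2 ≤ √((b - a) * G) ^ 2 := by gcongr
        _ = (b - a) * G := Real.sq_sqrt (by positivity)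
    have htri : ‖pev γ t - x₀‖ ≤ ‖pev γ t - pev γ a‖ + r := by
      calc ‖pev γ t - x₀‖ = ‖(pev γ t - pev γ a) + (pev γ a - x₀)‖ := by congr 1; abel
        _ ≤ _ := (norm_add_le _ _).trans (by gcongr)
    have htri2 : ‖pev γ t - x₀‖ ^ 2 ≤ (‖pev γ t - pev γ a‖ + r) ^ 2 := by gcongr
    nlinarith [sq_nonneg (‖pev γ t - pev γ a‖ - r)]
  have hT2 : c₂ * (b - a) ^ 2 ≤ c₁ / 4 := by
    have hsq : (b - a) ^ 2 ≤ c₁ / (4 * c₂) := by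
      calc (b - a) ^ 2 ≤ √(c₁ / (4 * c₂)) ^ 2 := by gcongr
        _ = c₁ / (4 * c₂) := Real.sq_sqrt (by positivity)
    rw [le_div_iff₀ (by positivity)] at hsq
    linarith
  have hint : ∫ t in Set.Icc a b,
      (c₁ * ‖g t‖ ^ 2 - c₂ * (1 + (2 * r ^ 2 + 2 * (b - a) * G))) ≤
      ∫ t in Set.Icc a b, L (pev γ t) (g t) := by
    refine setIntegral_mono_on ((hg2.const_mul c₁).sub (integrable_const _)) hLγ
      measurableSet_Icc fun t ht => le_trans ?_ (hL (pev γ t) (g t))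
    have := hpos t ht
    gcongr
  rw [integral_sub (hg2.const_mul c₁) (integrable_const _), integral_const_mul, integral_const,
    measureReal_restrict_apply_univ, Real.volume_real_Icc_of_le hab, smul_eq_mul, ← hG] at hint
  nlinarith [mul_le_mul_of_nonneg_right hT2 hG0]

/-- The action is bounded below on curves starting in a bounded set. -/
lemma epos_neg_action_le (hab : a ≤ b) (hc₁ : 0 < c₁) (hc₂ : 0 < c₂)
    (hL : ∀ x v : Eu n, c₁ * ‖v‖ ^ 2 - c₂ * (1 + ‖x - x₀‖ ^ 2) ≤ L x v)
    (htime : b - a ≤ √(c₁ / (4 * c₂))) (hr : ‖pev γ a - x₀‖ ≤ r) :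
    epos (-(action L a b γ)) ≤ ENNReal.ofReal (c₂ * (b - a) * (1 + 2 * r ^ 2)) := by
  unfold action
  split_ifs with h hLγ
  · have hbound := half_mul_integral_sq_sub_le_integral_lagrangian hab hc₁ hc₂ hL htime
      h.choose_spec.1 h.choose_spec.2 hr hLγ
    have hG0 : 0 ≤ ∫ u in Set.Icc a b, ‖h.choose u‖ ^ 2 :=
      integral_nonneg fun u => by positivity
    rw [← EReal.coe_neg, epos, if_neg (EReal.coe_ne_top _), EReal.toReal_coe]
    refine ENNReal.ofReal_le_ofReal ?_
    nlinarith
  · simp [epos]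
  · simp [epos]

/-- The action is large on curves that are not `1/2`-Hölder with a small constant. -/
lemma le_epos_action_of_not_modulus (hab : a ≤ b) (hc₁ : 0 < c₁) (hc₂ : 0 < c₂)
    (hL : ∀ x v : Eu n, c₁ * ‖v‖ ^ 2 - c₂ * (1 + ‖x - x₀‖ ^ 2) ≤ L x v)
    (htime : b - a ≤ √(c₁ / (4 * c₂))) (hr : ‖pev γ a - x₀‖ ≤ r) {R : ℝ}
    (hR : ¬ ∀ s t, dist (γ s) (γ t) ≤ √(R * dist s t)) :
    ENNReal.ofReal (c₁ / 2 * R - c₂ * (b - a) * (1 + 2 * r ^ 2)) ≤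
      epos (action L a b γ) := by
  unfold action
  split_ifs with h hLγ
  · have hbound := half_mul_integral_sq_sub_le_integral_lagrangian hab hc₁ hc₂ hL htime
      h.choose_spec.1 h.choose_spec.2 hr hLγ
    have hg2 := integrableOn_sq_of_integrableOn_lagrangian hc₁ hL h.choose_spec.1 hLγ
    have hRG : R ≤ ∫ u in Set.Icc a b, ‖h.choose u‖ ^ 2 := by
      by_contra! hlt
      refine hR fun s t => (dist_le_sqrt_of_integrableOn_sq h.choose_spec.1
        h.choose_spec.2 hg2 s t).trans (Real.sqrt_le_sqrt ?_)
      gcongr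
    rw [epos, if_neg (EReal.coe_ne_top _), EReal.toReal_coe]
    refine ENNReal.ofReal_le_ofReal ?_
    nlinarith
  · simp [epos]
  · simp [epos]

end Coercivity

/-- If the negative part of `F` has finite integral `≤ β` and `∫ F ≤ C`, then the positive part
has integral at most `C + β`. -/
lemma lintegral_epos_le {X : Type*} [MeasurableSpace X] {F : X → EReal} {π : Measure X}
    {C β : ℝ} (hβ : 0 ≤ β) (hneg : ∫⁻ x, epos (-(F x)) ∂π ≤ ENNReal.ofReal β)
    (hF : mint F π ≤ C) : ∫⁻ x, epos (F x) ∂π ≤ ENNReal.ofReal (C + β) := by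
  have hneg' : ((∫⁻ x, epos (-(F x)) ∂π : ℝ≥0∞) : EReal) ≤ (β : EReal) := by
    refine (EReal.coe_ennreal_le_coe_ennreal_iff.2 hneg).trans_eq ?_
    rw [EReal.coe_ennreal_ofReal, max_eq_left hβ]
  have hle : ((∫⁻ x, epos (F x) ∂π : ℝ≥0∞) : EReal) ≤ ((C + β : ℝ) : EReal) := by
    rw [EReal.coe_add]
    refine ((EReal.sub_le_iff_le_add (.inr (EReal.coe_ne_top _)) (.inr (EReal.coe_ne_bot _))).1
      hF).trans ?_
    gcongr
  rw [← EReal.coe_ennreal_le_coe_ennreal_iff, EReal.coe_ennreal_ofReal]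
  exact hle.trans (EReal.coe_le_coe_iff.2 (le_max_left _ _))

/-- **Prokhorov's theorem** in sequential form. -/
lemma exists_subseq_weakLim_of_isTight {X : Type*} [MetricSpace X] [SecondCountableTopology X]
    [MeasurableSpace X] [BorelSpace X] (μ : ℕ → Measure X) [∀ N, IsProbabilityMeasure (μ N)]
    (hμ : IsTightMeasureSet (Set.range μ)) :
    ∃ ψ : ℕ → ℕ, StrictMono ψ ∧ ∃ π : Measure X,
      IsProbabilityMeasure π ∧ WeakLim (fun k => μ (ψ k)) π := by
  let ν : ℕ → ProbabilityMeasure X := fun N => ⟨μ N, inferInstance⟩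
  have hν : IsCompact (closure (Set.range ν)) :=
    isCompact_closure_of_isTightMeasureSet <| hμ.subset <| by
      rintro _ ⟨_, ⟨N, rfl⟩, rfl⟩
      exact ⟨N, rfl⟩
  obtain ⟨π, -, ψ, hψ, hlim⟩ := hν.tendsto_subseq fun N => subset_closure (Set.mem_range_self N)
  exact ⟨ψ, hψ, π, inferInstance, ProbabilityMeasure.tendsto_iff_forall_integral_tendsto.1 hlim⟩

/-- **Compactness for unbounded potential energy (Theorem 4.2).**
Under the uniform strict convexity and quadratic growth conditions (ii'), (iii') and for
short times `b − a ≤ √(c₁/(4c₂))`, every sequence of probability measures on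
`C([a,b];ℝⁿ)` with initial marginals supported in a common compact set and uniformly
bounded actions is relatively compact with respect to weak convergence. -/
theorem compactness_unbounded_potential
    {n : ℕ} (hn : 1 ≤ n) {a b : ℝ} (hab : a < b)
    (L : Eu n → Eu n → ℝ)
    (hL1 : ContDiff ℝ (⊤ : ℕ∞) (Function.uncurry L))
    (c₀ : ℝ) (hc₀ : 0 < c₀)
    (hL2 : ∀ x v w : Eu n, c₀ * ‖w‖ ^ 2 ≤ fderiv ℝ (fderiv ℝ (L x)) v w w)
    (c₁ c₂ : ℝ) (hc₁ : 0 < c₁) (hc₂ : 0 < c₂) (x₀ : Eu n)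
    (hL3 : ∀ x v : Eu n, c₁ * ‖v‖ ^ 2 - c₂ * (1 + ‖x - x₀‖ ^ 2) ≤ L x v)
    (htime : b - a ≤ Real.sqrt (c₁ / (4 * c₂)))
    (πs : ℕ → Measure (CPath a b n)) (hprob : ∀ N, IsProbabilityMeasure (πs N))
    (K : Set (Eu n)) (hK : IsCompact K)
    (hKsupp : ∀ N, Measure.map (fun γ => pev γ a) (πs N) K = 1)
    (C : ℝ) (hC : ∀ N, mint (action L a b) (πs N) ≤ (C : EReal)) :
    ∀ φ : ℕ → ℕ, StrictMono φ →
      ∃ ψ : ℕ → ℕ, StrictMono ψ ∧ ∃ π : Measure (CPath a b n),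
        IsProbabilityMeasure π ∧ WeakLim (fun k => πs (φ (ψ k))) π := by
  intro φ _
  have := hprob
  refine exists_subseq_weakLim_of_isTight (fun k => πs (φ k)) ?_
  refine IsTightMeasureSet.subset ?_ (Set.range_comp_subset_range φ πs)
  have ha : a ∈ Set.Icc a b := ⟨le_rfl, hab.le⟩
  have hpev : (fun γ : CPath a b n => pev γ a) = fun γ => γ ⟨a, ha⟩ := by
    ext1 γ
    simp only [pev, ha, dif_pos]
  have hinit : ∀ N, ∀ᵐ γ ∂(πs N), γ ⟨a, ha⟩ ∈ K := by
    intro N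
    have hmeas : Measurable fun γ : CPath a b n => γ ⟨a, ha⟩ :=
      (by fun_prop : Continuous fun γ : CPath a b n => γ ⟨a, ha⟩).measurable
    have hsupp := hKsupp N
    rw [hpev, Measure.map_apply hmeas hK.measurableSet] at hsupp
    exact mem_ae_iff_prob_eq_one (hmeas hK.measurableSet) |>.2 hsupp
  obtain ⟨r, hr⟩ : ∃ r, ∀ x ∈ K, ‖x - x₀‖ ≤ r := by
    obtain ⟨r, hr⟩ := hK.isBounded.subset_closedBall x₀
    exact ⟨r, fun x hx => by simpa [dist_eq_norm] using hr hx⟩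
  set β := c₂ * (b - a) * (1 + 2 * r ^ 2) with hβ
  have hβ0 : 0 ≤ β := mul_nonneg (mul_nonneg hc₂.le (sub_nonneg.2 hab.le)) (by positivity)
  have hposPart : ∀ N, ∫⁻ γ, epos (action L a b γ) ∂(πs N) ≤ ENNReal.ofReal (C + β) := by
    refine fun N => lintegral_epos_le hβ0 ?_ (hC N)
    calc ∫⁻ γ, epos (-(action L a b γ)) ∂(πs N) ≤ ∫⁻ _, ENNReal.ofReal β ∂(πs N) := by
          refine lintegral_mono_ae ?_
          filter_upwards [hinit N] with γ hγ
          exact epos_neg_action_le hab.le hc₁ hc₂ hL3 htime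
            ((congrFun hpev γ).symm ▸ hr _ hγ)
      _ = ENNReal.ofReal β := by simp
  rw [isTightMeasureSet_iff_exists_isCompact_measure_compl_le]
  intro ε hε
  obtain ⟨M, hM0, hM⟩ : ∃ M : ℝ, 0 < M ∧ ENNReal.ofReal (C + β) / ENNReal.ofReal M ≤ ε := by
    have hlim : Tendsto (fun M : ℝ => ENNReal.ofReal (C + β) / ENNReal.ofReal M) atTop (𝓝 0) := by
      rw [← ENNReal.div_top (a := ENNReal.ofReal (C + β))]
      exact ENNReal.Tendsto.const_div ENNReal.tendsto_ofReal_atTop (.inr ENNReal.ofReal_ne_top)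
    exact ((eventually_gt_atTop 0).and (hlim.eventually_le_const hε)).exists
  set R := 2 / c₁ * (M + β) with hR
  have hRM : c₁ / 2 * R - β = M := by
    rw [hR]
    field_simp
    ring
  have hcompact : IsCompact {γ : CPath a b n | γ ⟨a, ha⟩ ∈ K ∧
      ∀ s t, dist (γ s) (γ t) ≤ √(R * dist s t)} := by
    refine isCompact_setOf_modulus (⟨a, ha⟩ : Set.Icc a b) hK (ω := fun d => √(R * d)) ?_
    have hcont : Continuous fun d : ℝ => √(R * d) := by fun_prop
    simpa using hcont.tendsto 0
  refine ⟨_, hcompact, ?_⟩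
  rintro _ ⟨N, rfl⟩
  refine le_trans ?_ hM
  rw [ENNReal.le_div_iff_mul_le (.inl (by simpa using hM0)) (.inl ENNReal.ofReal_ne_top),
    mul_comm, ← lintegral_indicator_const hcompact.measurableSet.compl]
  refine le_trans (lintegral_mono_ae ?_) (hposPart N)
  filter_upwards [hinit N] with γ hγ
  refine Set.indicator_apply_le' (fun hγR => ?_) fun _ => zero_le
  rw [← hRM]
  exact le_epos_action_of_not_modulus hab.le hc₁ hc₂ hL3 htime
    ((congrFun hpev γ).symm ▸ hr _ hγ) fun hmod => hγR ⟨hγ, hmod⟩
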